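/- For all integers p ≥ 1, r_j(e^{(p)}) = (v − v⁻¹) v^{p−2} Σ_{a=0}^{p−1} (−1)^a v^{−2a} Ĕ_j^{(a)} Ĕ_i^{(p)} Ĕ_j^{(p−1−a)}. -/

import Mathlib

noncomputable section

/-- The field ℚ(v) of rational functions over ℚ. -/
abbrev Qv : Type := RatFunc ℚ

/-- The indeterminate v. -/
def vv : Qv := RatFunc.X

/-- The quantum integer [a] = (v^a - v^{-a})/(v - v⁻¹). -/
def qint (a : ℕ) : Qv := (vv ^ (a : ℤ) - vv ^ (-(a : ℤ))) / (vv - vv⁻¹)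

/-- The quantum factorial [a]! = [a][a-1]⋯[1]. -/
def qfact : ℕ → Qv
  | 0 => 1
  | n + 1 => qint (n + 1) * qfact n

/-- Divided power x^{(p)} = x^p / [p]!. -/
def dp {A : Type} [Ring A] [Algebra Qv A] (x : A) (p : ℕ) : A :=
  (qfact p)⁻¹ • x ^ p

/-- The affine type A Cartan matrix entries c_{ij} = 2δ_{i,j} - δ_{i,j+1} - δ_{i,j-1}. -/
def cartan {m : ℕ} (i j : ZMod m) : ℤ :=
  (if i = j then 2 else 0) - (if i = j + 1 then 1 else 0) - (if i = j - 1 then 1 else 0)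

/-- Generators of the quantum affine algebra U(ŝl_m). -/
inductive Gen (m : ℕ) : Type
  | E : ZMod m → Gen m
  | F : ZMod m → Gen m
  | K : ZMod m → Gen m
  | Kinv : ZMod m → Gen m

abbrev FA (m : ℕ) := FreeAlgebra Qv (Gen m)

def fE {m : ℕ} (i : ZMod m) : FA m := FreeAlgebra.ι Qv (Gen.E i)
def fF {m : ℕ} (i : ZMod m) : FA m := FreeAlgebra.ι Qv (Gen.F i)
def fK {m : ℕ} (i : ZMod m) : FA m := FreeAlgebra.ι Qv (Gen.K i)
def fKinv {m : ℕ} (i : ZMod m) : FA m := FreeAlgebra.ι Qv (Gen.Kinv i)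

/-- The defining relations of the quantum affine algebra U(ŝl_m). -/
inductive URel (m : ℕ) : FA m → FA m → Prop
  | KK : ∀ i j, URel m (fK i * fK j) (fK j * fK i)
  | KKinv : ∀ i, URel m (fK i * fKinv i) 1
  | KinvK : ∀ i, URel m (fKinv i * fK i) 1
  | KE : ∀ i j, URel m (fK i * fE j) (vv ^ cartan i j • (fE j * fK i))
  | KF : ∀ i j, URel m (fK i * fF j) (vv ^ (-cartan i j) • (fF j * fK i))
  | EF : ∀ i j, URel m (fE i * fF j - fF j * fE i)
      (if i = j then (vv - vv⁻¹)⁻¹ • (fK i - fKinv i) else 0)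
  | serreE : ∀ i j, i ≠ j →
      URel m (∑ p ∈ Finset.range ((1 - cartan i j).toNat + 1),
        ((-1 : Qv) ^ p) • (dp (fE i) p * fE j * dp (fE i) ((1 - cartan i j).toNat - p))) 0
  | serreF : ∀ i j, i ≠ j →
      URel m (∑ p ∈ Finset.range ((1 - cartan i j).toNat + 1),
        ((-1 : Qv) ^ p) • (dp (fF i) p * fF j * dp (fF i) ((1 - cartan i j).toNat - p))) 0

/-- The quantum affine algebra U(ŝl_m), presented by generators and relations. -/
abbrev U (m : ℕ) := RingQuot (URel m)

def UE {m : ℕ} (i : ZMod m) : U m := RingQuot.mkAlgHom Qv (URel m) (fE i)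
def UF {m : ℕ} (i : ZMod m) : U m := RingQuot.mkAlgHom Qv (URel m) (fF i)
def UK {m : ℕ} (i : ZMod m) : U m := RingQuot.mkAlgHom Qv (URel m) (fK i)
def UKinv {m : ℕ} (i : ZMod m) : U m := RingQuot.mkAlgHom Qv (URel m) (fKinv i)

/-- The element e_r = Ĕ_r Ĕ_{r+1} − v^ε Ĕ_{r+1} Ĕ_r in U(ŝl_{n+1}). -/
def er (n r : ℕ) (ε : ℤ) : U (n + 1) :=
  UE (r : ZMod (n + 1)) * UE ((r : ZMod (n + 1)) + 1) -
    vv ^ ε • (UE ((r : ZMod (n + 1)) + 1) * UE (r : ZMod (n + 1)))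

/-- The element f_r = F̆_{r+1} F̆_r − v^{−ε} F̆_r F̆_{r+1} in U(ŝl_{n+1}). -/
def fr (n r : ℕ) (ε : ℤ) : U (n + 1) :=
  UF ((r : ZMod (n + 1)) + 1) * UF (r : ZMod (n + 1)) -
    vv ^ (-ε) • (UF (r : ZMod (n + 1)) * UF ((r : ZMod (n + 1)) + 1))

/-- The element k_r = K̆_r K̆_{r+1} in U(ŝl_{n+1}). -/
def kr (n r : ℕ) : U (n + 1) :=
  UK (r : ZMod (n + 1)) * UK ((r : ZMod (n + 1)) + 1)

/-- The image e_i ∈ U(ŝl_{n+1}) of the generator E_i, i ∈ ℤ/nℤ. -/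
def eElt (n r : ℕ) (ε : ℤ) (i : ZMod n) : U (n + 1) :=
  if i.val < r then UE ((i.val : ZMod (n + 1)))
  else if i.val = r then er n r ε
  else UE ((i.val + 1 : ℕ) : ZMod (n + 1))

def fElt (n r : ℕ) (ε : ℤ) (i : ZMod n) : U (n + 1) :=
  if i.val < r then UF ((i.val : ZMod (n + 1)))
  else if i.val = r then fr n r ε
  else UF ((i.val + 1 : ℕ) : ZMod (n + 1))

def kElt (n r : ℕ) (i : ZMod n) : U (n + 1) :=
  if i.val < r then UK ((i.val : ZMod (n + 1)))
  else if i.val = r then kr n r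
  else UK ((i.val + 1 : ℕ) : ZMod (n + 1))

def kinvElt (n r : ℕ) (i : ZMod n) : U (n + 1) :=
  if i.val < r then UKinv ((i.val : ZMod (n + 1)))
  else if i.val = r then UKinv (r : ZMod (n + 1)) * UKinv ((r : ZMod (n + 1)) + 1)
  else UKinv ((i.val + 1 : ℕ) : ZMod (n + 1))


/-- The positive half U⁺: the subalgebra of U(ŝl_3) generated by the Ĕ_k. -/
def Uplus : Subalgebra Qv (U 3) := Algebra.adjoin Qv (Set.range (UE (m := 3)))

/-- The generator Ĕ_k, viewed as an element of U⁺. -/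
def Egen (k : ZMod 3) : Uplus := ⟨UE k, Algebra.subset_adjoin ⟨k, rfl⟩⟩

/-- The submodule of U⁺ of homogeneous elements of multidegree d ∈ ℕ^{ℤ/3ℤ}. -/
def homog (d : ZMod 3 → ℕ) : Submodule Qv Uplus :=
  Submodule.span Qv
    {x | ∃ w : List (ZMod 3), (∀ c, w.count c = d c) ∧ x = (w.map Egen).prod}

/-- k·|y| = 2y_k − y_{k+1} − y_{k−1} for a multidegree |y| = d. -/
def kdot (k : ZMod 3) (d : ZMod 3 → ℕ) : ℤ :=
  2 * (d k : ℤ) - (d (k + 1) : ℤ) - (d (k - 1) : ℤ)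

/-- The family rr of ℚ(v)-linear maps r_k : U⁺ → U⁺ is the family of Lusztig's twisted
derivations: r_k(1) = 0, r_k(Ĕ_{k'}) = δ_{k,k'}, and
r_k(xy) = v^{k·|y|} r_k(x) y + x r_k(y) for homogeneous x, y. -/
def IsTwistedDerivation (rr : ZMod 3 → (Uplus →ₗ[Qv] Uplus)) : Prop :=
  (∀ k, rr k 1 = 0) ∧
  (∀ k k', rr k (Egen k') = if k = k' then 1 else 0) ∧
  (∀ k (dx dy : ZMod 3 → ℕ) (x y : Uplus), x ∈ homog dx → y ∈ homog dy →
    rr k (x * y) = vv ^ kdot k dy • (rr k x * y) + x * rr k y)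

/-- The element e = Ĕ_i Ĕ_j − v⁻¹ Ĕ_j Ĕ_i ∈ U⁺, with j = i + 1. -/
def ee (i : ZMod 3) : Uplus :=
  Egen i * Egen (i + 1) - vv⁻¹ • (Egen (i + 1) * Egen i)

lemma vv_ne_zero : vv ≠ 0 := RatFunc.X_ne_zero

lemma vv_pow_ne_one {n : ℕ} (hn : n ≠ 0) : vv ^ n ≠ 1 := by
  intro h
  have h' : algebraMap (Polynomial ℚ) Qv (Polynomial.X ^ n) = algebraMap (Polynomial ℚ) Qv 1 := by
    rw [map_pow, map_one, RatFunc.algebraMap_X]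
    exact h
  have := congrArg Polynomial.natDegree (RatFunc.algebraMap_injective ℚ h')
  simp at this
  exact hn this

lemma vv_zpow_sub_ne_zero {n : ℕ} (hn : n ≠ 0) : vv ^ (n : ℤ) - vv ^ (-(n : ℤ)) ≠ 0 := by
  intro h
  have h2 : vv ^ (n + n) = 1 := by
    rw [zpow_neg, zpow_natCast, sub_eq_zero] at h
    rw [pow_add]
    nth_rewrite 1 [h]
    exact inv_mul_cancel₀ (pow_ne_zero _ vv_ne_zero)
  exact vv_pow_ne_one (by omega) h2

lemma vv_sub_inv_ne_zero : vv - vv⁻¹ ≠ 0 := by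
  simpa using vv_zpow_sub_ne_zero one_ne_zero

lemma qint_ne_zero {n : ℕ} (hn : n ≠ 0) : qint n ≠ 0 :=
  div_ne_zero (vv_zpow_sub_ne_zero hn) vv_sub_inv_ne_zero

@[simp] lemma qint_zero : qint 0 = 0 := by simp [qint]

@[simp] lemma qint_one : qint 1 = 1 := by
  simp [qint, div_self vv_sub_inv_ne_zero]

lemma qint_add (a b : ℕ) :
    qint (a + b) = vv ^ (a : ℤ) * qint b + vv ^ (-(b : ℤ)) * qint a := by
  have hv := vv_ne_zero
  unfold qint
  rw [← mul_div_assoc, ← mul_div_assoc, ← add_div]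
  congr 1
  rw [mul_sub, mul_sub, ← zpow_add₀ hv, ← zpow_add₀ hv, ← zpow_add₀ hv, ← zpow_add₀ hv]
  push_cast
  rw [show -(b : ℤ) + a = a + -b by ring, show -(b : ℤ) + -a = -(a + b) by ring]
  ring

lemma qint_two : qint 2 = vv + vv⁻¹ := by
  simpa using qint_add 1 1

lemma qfact_inv (n : ℕ) : (qfact n)⁻¹ = qint (n + 1) * (qfact (n + 1))⁻¹ := by
  rw [qfact, mul_inv, mul_inv_cancel_left₀ (qint_ne_zero n.succ_ne_zero)]

section DividedPowers

variable {A : Type} [Ring A] [Algebra Qv A]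

@[simp] lemma dp_zero (x : A) : dp x 0 = 1 := by simp [dp, qfact]

@[simp] lemma dp_one (x : A) : dp x 1 = x := by simp [dp, qfact]

lemma dp_two (x : A) : dp x 2 = (qint 2)⁻¹ • (x * x) := by simp [dp, qfact, pow_two]

lemma dp_mul_self (x : A) (n : ℕ) : dp x n * x = qint (n + 1) • dp x (n + 1) := by
  rw [dp, dp, smul_mul_assoc, ← pow_succ, qfact_inv, mul_smul]

lemma self_mul_dp (x : A) (n : ℕ) : x * dp x n = qint (n + 1) • dp x (n + 1) := by
  rw [dp, dp, mul_smul_comm, ← pow_succ', qfact_inv, mul_smul]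

lemma mul_pow_of_mul_eq_smul {x e : A} {c : Qv} (h : x * e = c • (e * x)) (n : ℕ) :
    x * e ^ n = c ^ n • (e ^ n * x) := by
  induction n with
  | zero => simp
  | succ n ih =>
    rw [pow_succ, ← mul_assoc, ih, smul_mul_assoc, mul_assoc, h, mul_smul_comm, smul_smul,
      pow_succ, mul_assoc]

/-- Moving `y` through a divided power of `x`, where `e = x y - v⁻¹ y x` satisfies
`x e = v e x`. -/
lemma mul_dp_eq {x y e : A} (he : e = x * y + (-vv⁻¹) • (y * x)) (hxe : x * e = vv • (e * x))
    (n : ℕ) :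
    e * dp x n = dp x (n + 1) * y - vv ^ (-((n : ℤ) + 1)) • (y * dp x (n + 1)) := by
  have hv := vv_ne_zero
  have hxy : x * y = e + vv⁻¹ • (y * x) := by rw [he, neg_smul]; abel
  have key : ∀ n : ℕ, x ^ (n + 1) * y =
      vv ^ (-((n : ℤ) + 1)) • (y * x ^ (n + 1)) + qint (n + 1) • (e * x ^ n) := by
    intro n
    induction n with
    | zero => simp [hxy, add_comm]
    | succ n ih =>
      have hq : qint (n + 1 + 1) = vv ^ (-((n : ℤ) + 1)) + qint (n + 1) * vv := by
        rw [add_comm (n + 1) 1, qint_add]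
        push_cast
        simp only [qint_one, mul_one, zpow_one]
        ring
      rw [pow_succ', mul_assoc, ih, mul_add, mul_smul_comm, mul_smul_comm, ← mul_assoc,
        ← mul_assoc, hxy, hxe, add_mul, hq]
      simp only [smul_mul_assoc, smul_add, smul_smul, add_smul, mul_assoc, ← pow_succ']
      rw [← zpow_sub_one₀ hv, show -((n : ℤ) + 1) - 1 = -(((n + 1 : ℕ) : ℤ) + 1) by push_cast; ring]
      abel
  have hdp : e * dp x n = (qfact (n + 1))⁻¹ • (qint (n + 1) • (e * x ^ n)) := by
    rw [dp, mul_smul_comm, qfact_inv, mul_comm, mul_smul]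
  rw [hdp, eq_sub_of_add_eq' (key n).symm, dp, smul_sub, smul_mul_assoc, mul_smul_comm,
    smul_comm]

lemma mul_dp_of_mul_eq_smul {y e : A} {c : Qv} (h : e * y = c • (y * e)) (n : ℕ) :
    e * dp y n = c ^ n • (dp y n * e) := by
  rw [dp, mul_smul_comm, mul_pow_of_mul_eq_smul h, smul_mul_assoc, smul_comm]

/-- A higher order quantum Serre type expansion of `e^{(n)} x`. -/
lemma dp_mul_eq_sum {x y e : A} (he : e = x * y + (-vv⁻¹) • (y * x))
    (hxe : x * e = vv • (e * x)) (hey : e * y = vv • (y * e)) (n : ℕ) :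
    dp e n * x = ∑ a ∈ Finset.range (n + 1), ((-1 : Qv) ^ a * vv ^ (-(2 * (a : ℤ)))) •
      (dp y a * dp x (n + 1) * dp y (n - a)) := by
  have hv := vv_ne_zero
  induction n with
  | zero => simp
  | succ n ih =>
    apply smul_right_injective A (qint_ne_zero n.succ_ne_zero)
    simp only [Nat.succ_eq_add_one]
    rw [← smul_mul_assoc, ← self_mul_dp, mul_assoc, ih, Finset.mul_sum]
    set T : ℕ → A := fun a => dp y a * dp x (n + 1 + 1) * dp y (n + 1 - a) with hT
    have hterm : ∀ a ∈ Finset.range (n + 1),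
        e * (((-1 : Qv) ^ a * vv ^ (-(2 * (a : ℤ)))) •
          (dp y a * dp x (n + 1) * dp y (n - a))) =
        ((-1 : Qv) ^ a * vv ^ (-(a : ℤ)) * qint (n + 1 - a)) • T a +
        ((-1 : Qv) ^ (a + 1) * vv ^ (-((a + 1 : ℕ) : ℤ) - n - 1) * qint (a + 1)) •
          T (a + 1) := by
      intro a ha
      obtain ⟨b, rfl⟩ := Nat.exists_eq_add_of_le (Nat.lt_succ_iff.mp (Finset.mem_range.mp ha))
      have h1 : a + b - a = b := by omega
      have h2 : a + b + 1 - a = b + 1 := by omega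
      have h3 : a + b + 1 - (a + 1) = b := by omega
      have h4 : vv ^ (-(2 * (a : ℤ))) * vv ^ a = vv ^ (-(a : ℤ)) := by
        rw [← zpow_natCast, ← zpow_add₀ hv]; congr 1; ring
      have h5 : vv ^ (-(a : ℤ)) * vv ^ (-(((a + b + 1 : ℕ) : ℤ) + 1)) =
          vv ^ (-((a + 1 : ℕ) : ℤ) - ((a + b : ℕ) : ℤ) - 1) := by
        rw [← zpow_add₀ hv]; congr 1; push_cast; ring
      simp only [hT, h1, h2, h3]
      rw [mul_smul_comm, ← mul_assoc, ← mul_assoc, mul_dp_of_mul_eq_smul hey, smul_mul_assoc,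
        smul_mul_assoc, smul_smul, mul_assoc (dp y a) e, mul_dp_eq he hxe, mul_sub, sub_mul,
        mul_smul_comm, smul_mul_assoc, ← mul_assoc (dp y a) y, dp_mul_self y a,
        ← mul_assoc (dp y a), mul_assoc _ y, self_mul_dp, mul_smul_comm, smul_mul_assoc,
        smul_mul_assoc, smul_sub, smul_smul, smul_smul, smul_smul, mul_assoc _ _ (vv ^ a), h4,
        sub_eq_add_neg, ← neg_smul, ← h5]
      congr 2
      ring
    rw [Finset.sum_congr rfl hterm, Finset.sum_add_distrib, Finset.smul_sum]
    have hfst := Finset.sum_range_succ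
      (fun a : ℕ => ((-1 : Qv) ^ a * vv ^ (-(a : ℤ)) * qint (n + 1 - a)) • T a) (n + 1)
    have hsnd := Finset.sum_range_succ'
      (fun a : ℕ => ((-1 : Qv) ^ a * vv ^ (-(a : ℤ) - n - 1) * qint a) • T a) (n + 1)
    simp only [Nat.sub_self, qint_zero, mul_zero, zero_smul, add_zero] at hfst hsnd
    rw [← hfst, ← hsnd, ← Finset.sum_add_distrib]
    refine Finset.sum_congr rfl fun a ha => ?_
    rw [← add_smul, smul_smul]
    congr 1
    obtain ⟨b, hb⟩ := Nat.exists_eq_add_of_le (Nat.lt_succ_iff.mp (Finset.mem_range.mp ha))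
    have h1 : n + 1 - a = b := by omega
    have h2 : vv ^ (-(2 * (a : ℤ))) * vv ^ (a : ℤ) = vv ^ (-(a : ℤ)) := by
      rw [← zpow_add₀ hv]; congr 1; ring
    have h3 : vv ^ (-(2 * (a : ℤ))) * vv ^ (-(b : ℤ)) = vv ^ (-(a : ℤ) - n - 1) := by
      rw [← zpow_add₀ hv]; congr 1; omega
    rw [h1, ← h2, ← h3, hb, qint_add]
    ring

lemma serre_of_sum_eq_zero {x y : A}
    (h : ∑ p ∈ Finset.range 3, ((-1 : Qv) ^ p) • (dp x p * y * dp x (2 - p)) = 0) :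
    y * (x * x) + x * x * y = (vv + vv⁻¹) • (x * y * x) := by
  have h2 := qint_ne_zero two_ne_zero
  have := congrArg (qint 2 • ·) h
  simp only [Finset.sum_range_succ, Finset.sum_range_zero, dp_two, dp_one, dp_zero, pow_zero,
    pow_one, neg_one_sq, Nat.sub_zero, Nat.sub_self, Nat.add_one_sub_one, mul_smul_comm,
    smul_mul_assoc, one_smul, one_mul, mul_one, smul_add, smul_smul, mul_inv_cancel₀ h2, zero_add,
    smul_zero, neg_smul, smul_neg] at this
  rw [← qint_two, ← sub_eq_zero, ← this]
  abel

lemma mul_qcomm_of_serre {x y : A}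
    (h : y * (x * x) + x * x * y = (vv + vv⁻¹) • (x * y * x)) :
    x * (x * y + (-vv⁻¹) • (y * x)) = vv • ((x * y + (-vv⁻¹) • (y * x)) * x) := by
  rw [← sub_eq_zero] at h ⊢
  rw [← h]
  simp only [mul_add, add_mul, mul_smul_comm, smul_mul_assoc, smul_add, smul_smul, mul_neg,
    neg_mul, smul_neg, neg_smul, mul_inv_cancel₀ vv_ne_zero, one_smul, add_smul, mul_assoc]
  abel

lemma qcomm_mul_of_serre {x y : A}
    (h : x * (y * y) + y * y * x = (vv + vv⁻¹) • (y * x * y)) :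
    (x * y + (-vv⁻¹) • (y * x)) * y = vv • (y * (x * y + (-vv⁻¹) • (y * x))) := by
  rw [← sub_eq_zero] at h ⊢
  rw [← h]
  simp only [mul_add, add_mul, mul_smul_comm, smul_mul_assoc, smul_add, smul_smul, mul_neg,
    neg_mul, smul_neg, neg_smul, mul_inv_cancel₀ vv_ne_zero, one_smul, add_smul, mul_assoc]
  abel

end DividedPowers

lemma cartan_eq_neg_one {i j : ZMod 3} (h : i ≠ j) : cartan i j = -1 := by
  revert i j; decide

lemma Egen_serre {i j : ZMod 3} (h : i ≠ j) :
    Egen j * (Egen i * Egen i) + Egen i * Egen i * Egen j =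
      (vv + vv⁻¹) • (Egen i * Egen j * Egen i) := by
  have hrel := RingQuot.mkAlgHom_rel Qv (URel.serreE i j h)
  rw [cartan_eq_neg_one h] at hrel
  have hdp : ∀ (k : ZMod 3) (p : ℕ),
      RingQuot.mkAlgHom Qv (URel 3) (dp (fE k) p) = dp (UE k) p := fun k p => by
    rw [dp, map_smul, map_pow]; rfl
  have hgen : ∀ k : ZMod 3, RingQuot.mkAlgHom Qv (URel 3) (fE k) = UE k := fun _ => rfl
  simp only [map_sum, map_smul, map_mul, map_zero, hdp, hgen] at hrel
  exact Subtype.ext (serre_of_sum_eq_zero hrel)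

lemma ZMod.three_ne_add_one (i : ZMod 3) : i ≠ i + 1 := by
  revert i; decide

lemma ee_eq_add (i : ZMod 3) :
    ee i = Egen i * Egen (i + 1) + (-vv⁻¹) • (Egen (i + 1) * Egen i) := by
  apply Subtype.ext
  change UE i * UE (i + 1) - vv⁻¹ • (UE (i + 1) * UE i) =
    UE i * UE (i + 1) + (-vv⁻¹) • (UE (i + 1) * UE i)
  rw [neg_smul, ← sub_eq_add_neg]

lemma Egen_mul_ee (i : ZMod 3) : Egen i * ee i = vv • (ee i * Egen i) := by
  rw [ee_eq_add]
  exact mul_qcomm_of_serre (A := Uplus) (Egen_serre (ZMod.three_ne_add_one i))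

lemma ee_mul_Egen (i : ZMod 3) : ee i * Egen (i + 1) = vv • (Egen (i + 1) * ee i) := by
  rw [ee_eq_add]
  exact qcomm_mul_of_serre (A := Uplus) (Egen_serre (ZMod.three_ne_add_one i).symm)

lemma prod_map_Egen_mem_homog (w : List (ZMod 3)) :
    (w.map Egen).prod ∈ homog (fun c => w.count c) :=
  Submodule.subset_span ⟨w, fun _ => rfl, rfl⟩

lemma Egen_mem_homog (k : ZMod 3) : Egen k ∈ homog (fun c => [k].count c) := by
  simpa using prod_map_Egen_mem_homog [k]

lemma mul_mem_homog {d d' : ZMod 3 → ℕ} {x y : Uplus} (hx : x ∈ homog d) (hy : y ∈ homog d') :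
    x * y ∈ homog (d + d') := by
  have h := Submodule.mul_mem_mul hx hy
  rw [homog, homog, Submodule.span_mul_span] at h
  refine Submodule.span_mono ?_ h
  rintro _ ⟨_, ⟨w, hw, rfl⟩, _, ⟨w', hw', rfl⟩, rfl⟩
  exact ⟨w ++ w', fun c => by simp [hw, hw'], by simp⟩

lemma ee_mem_homog (i : ZMod 3) : ee i ∈ homog (fun c => [i, i + 1].count c) := by
  rw [ee_eq_add]
  refine add_mem ?_ (Submodule.smul_mem _ _ ?_)
  · simpa using prod_map_Egen_mem_homog [i, i + 1]
  · have h := prod_map_Egen_mem_homog [i + 1, i]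
    simp only [(List.Perm.swap i (i + 1) []).count_eq] at h
    simpa using h

lemma ee_pow_mem_homog (i : ZMod 3) (n : ℕ) : ∃ d, ee i ^ n ∈ homog d := by
  induction n with
  | zero => exact ⟨_, by simpa using prod_map_Egen_mem_homog []⟩
  | succ n ih =>
    obtain ⟨d, hd⟩ := ih
    exact ⟨_, pow_succ (ee i) n ▸ mul_mem_homog hd (ee_mem_homog i)⟩

lemma IsTwistedDerivation.apply_ee {rr : ZMod 3 → (Uplus →ₗ[Qv] Uplus)}
    (hrr : IsTwistedDerivation rr) (i : ZMod 3) :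
    rr (i + 1) (ee i) = (1 - vv ^ (-2 : ℤ)) • Egen i := by
  obtain ⟨-, hgen, hmul⟩ := hrr
  have hk : kdot (i + 1) (fun c => [i].count c) = -1 := by revert i; decide
  have hne := (ZMod.three_ne_add_one i).symm
  rw [ee_eq_add, map_add, map_smul, hmul _ _ _ _ _ (Egen_mem_homog i) (Egen_mem_homog (i + 1)),
    hmul _ _ _ _ _ (Egen_mem_homog (i + 1)) (Egen_mem_homog i), hgen, hgen, if_pos rfl,
    if_neg hne, hk, sub_eq_add_neg, add_smul, one_smul, zero_mul, smul_zero, zero_add, one_mul,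
    mul_one, mul_zero, add_zero, smul_smul, zpow_neg_one, neg_mul, zpow_neg, zpow_ofNat, pow_two,
    mul_inv]

lemma IsTwistedDerivation.apply_ee_pow {rr : ZMod 3 → (Uplus →ₗ[Qv] Uplus)}
    (hrr : IsTwistedDerivation rr) (i : ZMod 3) (n : ℕ) :
    rr (i + 1) (ee i ^ (n + 1)) =
      ((1 - vv ^ (-2 : ℤ)) * vv ^ (n : ℤ) * qint (n + 1)) • (ee i ^ n * Egen i) := by
  have hv := vv_ne_zero
  induction n with
  | zero => simpa using hrr.apply_ee i
  | succ n ih =>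
    obtain ⟨d, hd⟩ := ee_pow_mem_homog i (n + 1)
    have hk : kdot (i + 1) (fun c => [i, i + 1].count c) = 1 := by
      clear ih hd; revert i; decide
    have hq : vv ^ ((n + 1 : ℕ) : ℤ) * qint (n + 1 + 1) =
        vv * (vv ^ (n : ℤ) * qint (n + 1)) * vv + 1 := by
      rw [add_comm (n + 1) 1, qint_add, mul_add, qint_one, mul_one, ← zpow_add₀ hv,
        add_neg_cancel, zpow_zero]
      push_cast
      rw [zpow_add₀ hv, zpow_one]
      ring
    rw [pow_succ, hrr.2.2 _ _ _ _ _ hd (ee_mem_homog i), hk, ih, hrr.apply_ee, smul_mul_assoc,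
      mul_assoc (ee i ^ n), Egen_mul_ee, mul_smul_comm, mul_smul_comm, ← mul_assoc, ← pow_succ, smul_smul,
      smul_smul, ← add_smul, mul_assoc (1 - vv ^ (-2 : ℤ)) (vv ^ ((n + 1 : ℕ) : ℤ)), hq]
    congr 1
    rw [zpow_one]
    ring

/-- for p ≥ 1,
r_j(e^{(p)}) = (v − v⁻¹) v^{p−2} Σ_{a=0}^{p−1} (−1)^a v^{−2a} Ĕ_j^{(a)} Ĕ_i^{(p)} Ĕ_j^{(p−1−a)}. -/
theorem twisted_derivation_rj
    (rr : ZMod 3 → (Uplus →ₗ[Qv] Uplus)) (hrr : IsTwistedDerivation rr)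
    (i : ZMod 3) (p : ℕ) (hp : 1 ≤ p) :
    rr (i + 1) (dp (ee i) p) =
      ((vv - vv⁻¹) * vv ^ ((p : ℤ) - 2)) •
        ∑ a ∈ Finset.range p,
          ((-1 : Qv) ^ a * vv ^ (-(2 * (a : ℤ)))) •
            (dp (Egen (i + 1)) a * dp (Egen i) p * dp (Egen (i + 1)) (p - 1 - a)) := by
  obtain ⟨n, rfl⟩ := Nat.exists_eq_add_of_le' hp
  have hv := vv_ne_zero
  have hc : (1 - vv ^ (-2 : ℤ)) * vv ^ (n : ℤ) = (vv - vv⁻¹) * vv ^ (((n + 1 : ℕ) : ℤ) - 2) := by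
    rw [sub_mul, sub_mul, ← zpow_add₀ hv, ← zpow_neg_one, ← zpow_add₀ hv, ← zpow_one_add₀ hv,
      one_mul]
    push_cast
    congr 2 <;> ring
  have hsum := dp_mul_eq_sum (A := Uplus) (ee_eq_add i) (Egen_mul_ee i) (ee_mul_Egen i) n
  rw [Nat.add_sub_cancel, ← hsum, ← hc, dp, dp, map_smul, hrr.apply_ee_pow, smul_mul_assoc,
    qfact_inv n, smul_smul, smul_smul]
  congr 1
  ring

end
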